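/- Let K : [0,1] × [0,1] → ℝ be continuous with K(x,y) ≥ 0 for all x, y, and such that for every y ∈ [0,1] there exists x ∈ [0,1] with K(x,y) > 0. Define the operator M_K on the space E of continuous real functions on [0,1] by (M_K f)(x) = ∫₀¹ K(x,y) f(y) dy; then M_K maps the positive cone C into itself, and c(M_K) < 1 if and only if there exist functions g₁, g₂ : [0,1] → ℝ₊ and a real A > 0 such that A⁻¹·g₁(x)·g₂(y) ≤ K(x,y) ≤ A·g₁(x)·g₂(y) for all x, y ∈ [0,1]. -/

import Mathlib

/-- `aleph f g = sup {b ≥ 0 : b·f ≤ g pointwise}`. -/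
noncomputable def aleph {X : Type*} (f g : X → ℝ) : ℝ :=
  sSup {b : ℝ | 0 ≤ b ∧ ∀ x, b * f x ≤ g x}

/-- `m(f,g) = ℵ(f,g)·ℵ(g,f)`. -/
noncomputable def mRatio {X : Type*} (f g : X → ℝ) : ℝ := aleph f g * aleph g f

/-- The pseudo-Hilbert distance `d(f,g) = (1 − m(f,g))/(1 + m(f,g))`. -/
noncomputable def dProj {X : Type*} (f g : X → ℝ) : ℝ :=
  (1 - mRatio f g) / (1 + mRatio f g)

/-- Membership in the positive cone `C = {f ∈ E : f ≠ 0 and f(x) ≥ 0 for all x}`. -/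
def InCone {X : Type*} (E : Submodule ℝ (X → ℝ)) (f : X → ℝ) : Prop :=
  f ∈ E ∧ f ≠ 0 ∧ ∀ x, 0 ≤ f x
open MeasureTheory

/-- Membership in the positive cone of functions on `[0,1]`:
`C = {f ∈ E : f ≠ 0 and f(x) ≥ 0 for all x}`, where `E` is the space of
continuous real-valued functions on `[0,1]`. -/
def InConeC (f : unitInterval → ℝ) : Prop :=
  Continuous f ∧ f ≠ 0 ∧ ∀ x, 0 ≤ f x

/-- The kernel operator `M_K f (x) = ∫₀¹ K(x,y)·f(y) dy`. -/
noncomputable def MK (K : unitInterval → unitInterval → ℝ)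
    (f : unitInterval → ℝ) : unitInterval → ℝ :=
  fun x => ∫ y : unitInterval, K x y * f y

/-- The contraction coefficient `c(M_K) = sup {d(M_K f, M_K g) : f, g ∈ C}`. -/
noncomputable def cK (K : unitInterval → unitInterval → ℝ) : ℝ :=
  sSup {r : ℝ | ∃ f g : unitInterval → ℝ, InConeC f ∧ InConeC g ∧
    r = dProj (MK K f) (MK K g)}

section Aleph

variable {X : Type*} {f g : X → ℝ}

theorem bddAbove_aleph_set (hf : ∃ x, 0 < f x) :
    BddAbove {b : ℝ | 0 ≤ b ∧ ∀ x, b * f x ≤ g x} := by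
  obtain ⟨x, hx⟩ := hf
  exact ⟨g x / f x, fun b hb => (le_div_iff₀ hx).2 (hb.2 x)⟩

theorem aleph_nonneg : 0 ≤ aleph f g := Real.sSup_nonneg fun _ hb => hb.1

theorem le_aleph (hf : ∃ x, 0 < f x) {b : ℝ} (hb : 0 ≤ b) (h : ∀ x, b * f x ≤ g x) :
    b ≤ aleph f g :=
  le_csSup (bddAbove_aleph_set hf) ⟨hb, h⟩

theorem aleph_mul_le (hf : ∀ x, 0 ≤ f x) (hg : ∀ x, 0 ≤ g x) (x : X) :
    aleph f g * f x ≤ g x := by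
  rcases (hf x).eq_or_lt with h | h
  · simpa [← h] using hg x
  · rw [← le_div_iff₀ h]
    exact Real.sSup_le (fun b hb => (le_div_iff₀ h).2 (hb.2 x)) (div_nonneg (hg x) h.le)

theorem mRatio_nonneg : 0 ≤ mRatio f g := mul_nonneg aleph_nonneg aleph_nonneg

theorem dProj_le_one : dProj f g ≤ 1 := by
  have h : 0 ≤ mRatio f g := mRatio_nonneg
  unfold dProj
  rw [div_le_one (by linarith)]
  linarith

theorem dProj_self_nonneg (hf : ∀ x, 0 ≤ f x) (hf' : ∃ x, 0 < f x) : 0 ≤ dProj f f := by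
  obtain ⟨x, hx⟩ := hf'
  have h0 : 0 ≤ aleph f f := aleph_nonneg
  have h1 : aleph f f ≤ 1 := by
    have := aleph_mul_le hf hf x
    exact le_of_mul_le_mul_right (by linarith) hx
  unfold dProj mRatio
  have : aleph f f * aleph f f ≤ 1 := mul_le_one₀ h1 h0 h1
  exact div_nonneg (by linarith) (by nlinarith)

/-- A lower bound on `mRatio` gives a cross-ratio inequality. -/
theorem cross_le_of_le_mRatio (hf : ∀ x, 0 ≤ f x) (hg : ∀ x, 0 ≤ g x) {β : ℝ}
    (h : β ≤ mRatio f g) (x x' : X) : β * (f x * g x') ≤ f x' * g x :=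
  calc β * (f x * g x') ≤ mRatio f g * (f x * g x') :=
        mul_le_mul_of_nonneg_right h (mul_nonneg (hf x) (hg x'))
    _ = (aleph g f * g x') * (aleph f g * f x) := by unfold mRatio; ring
    _ ≤ f x' * g x :=
        mul_le_mul (aleph_mul_le hg hf x') (aleph_mul_le hf hg x)
          (mul_nonneg aleph_nonneg (hf x)) (hf x')

/-- A cross-ratio inequality gives a lower bound on `mRatio`. -/
theorem le_mRatio_of_cross_le (hf : ∀ x, 0 ≤ f x) (hf' : ∃ x, 0 < f x)
    (hg' : ∃ x, 0 < g x) {β : ℝ} (hβ : 0 < β)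
    (h : ∀ x x', β * (f x * g x') ≤ f x' * g x) : β ^ 2 ≤ mRatio f g := by
  obtain ⟨z, hz⟩ := hg'
  have hfz : 0 < f z := by
    obtain ⟨w, hw⟩ := hf'
    refine (hf z).lt_of_ne fun h0 => ?_
    have := h w z
    rw [← h0, zero_mul] at this
    exact absurd this (not_le.2 (by positivity))
  have h1 : β * (g z / f z) ≤ aleph f g := by
    refine le_aleph hf' (by positivity) fun x => ?_
    have := h x z
    rw [mul_div_assoc', div_mul_eq_mul_div, div_le_iff₀ hfz]
    linarith
  have h2 : β * (f z / g z) ≤ aleph g f := by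
    refine le_aleph ⟨z, hz⟩ (by positivity) fun x => ?_
    have := h z x
    rw [mul_div_assoc', div_mul_eq_mul_div, div_le_iff₀ hz]
    linarith
  calc β ^ 2 = (β * (g z / f z)) * (β * (f z / g z)) := by field_simp
    _ ≤ mRatio f g := mul_le_mul h1 h2 (by positivity) aleph_nonneg

end Aleph

theorem InConeC.exists_pos {f : unitInterval → ℝ} (hf : InConeC f) : ∃ x, 0 < f x := by
  obtain ⟨x, hx⟩ := Function.ne_iff.1 hf.2.1
  exact ⟨x, (hf.2.2 x).lt_of_ne' hx⟩

theorem integrable_of_continuous_unitInterval {f : unitInterval → ℝ} (hf : Continuous f) :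
    Integrable f :=
  hf.integrable_of_hasCompactSupport (HasCompactSupport.of_compactSpace f)

instance isOpenPosMeasure_volume_unitInterval :
    (volume : Measure unitInterval).IsOpenPosMeasure where
  open_pos U hU hne := by
    obtain ⟨a, b, hab, hsub⟩ := hU.exists_Ioo_subset hne
    refine (lt_of_lt_of_le ?_ (measure_mono hsub)).ne'
    rw [unitInterval.volume_Ioo, ENNReal.ofReal_pos, sub_pos]
    exact hab

theorem integral_unitInterval_pos {f : unitInterval → ℝ} (hf : Continuous f)
    (h0 : ∀ x, 0 ≤ f x) {z : unitInterval} (hz : 0 < f z) : 0 < ∫ x, f x :=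
  hf.integral_pos_of_hasCompactSupport_nonneg_nonzero (HasCompactSupport.of_compactSpace f)
    h0 hz.ne'

/-- A continuous function whose integral against every element of the cone is nonnegative
is itself nonnegative. -/
theorem nonneg_of_integral_mul_nonneg {φ : unitInterval → ℝ} (hφ : Continuous φ)
    (h : ∀ f, InConeC f → 0 ≤ ∫ y, φ y * f y) (y : unitInterval) : 0 ≤ φ y := by
  by_contra! hy
  have hc : Continuous fun z => max (-φ z) 0 := hφ.neg.max continuous_const
  have hpos : 0 < max (-φ y) 0 := lt_max_of_lt_left (by linarith)
  have h1 := h (fun z => max (-φ z) 0)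
    ⟨hc, fun h0 => hpos.ne' (congrFun h0 y), fun z => le_max_right _ _⟩
  have h2 := integral_unitInterval_pos (f := fun z => max (-φ z) 0 ^ 2) (hc.pow 2) (fun z => sq_nonneg _) (pow_pos hpos 2)
  have h3 : (∫ z, φ z * max (-φ z) 0) = -∫ z, max (-φ z) 0 ^ 2 := by
    rw [← integral_neg]
    congr 1 with z
    rcases max_cases (-φ z) 0 with ⟨h, -⟩ | ⟨h, -⟩ <;> rw [h] <;> ring
  linarith

section Kernel

variable {K : unitInterval → unitInterval → ℝ}

theorem continuous_kernel_mul
    (hK : Continuous fun p : unitInterval × unitInterval => K p.1 p.2)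
    {f : unitInterval → ℝ} (hf : Continuous f) (x : unitInterval) :
    Continuous fun y => K x y * f y :=
  (hK.comp (Continuous.prodMk_right x)).mul hf

theorem inConeC_MK (hK : Continuous fun p : unitInterval × unitInterval => K p.1 p.2)
    (hK0 : ∀ x y, 0 ≤ K x y) (hKpos : ∀ y, ∃ x, 0 < K x y)
    {f : unitInterval → ℝ} (hf : InConeC f) : InConeC (MK K f) := by
  refine ⟨?_, fun h0 => ?_, fun x => integral_nonneg fun y => mul_nonneg (hK0 x y) (hf.2.2 y)⟩
  · have h := continuous_parametric_integral_of_continuous (μ := volume)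
      (f := fun x y => K x y * f y) (hK.mul (hf.1.comp continuous_snd)) isCompact_univ
    simp only [Measure.restrict_univ] at h
    exact h
  · obtain ⟨y, hy⟩ := hf.exists_pos
    obtain ⟨x, hx⟩ := hKpos y
    have h := integral_unitInterval_pos (continuous_kernel_mul hK hf.1 x)
      (fun y => mul_nonneg (hK0 x y) (hf.2.2 y)) (mul_pos hx hy)
    exact h.ne' (congrFun h0 x)

theorem integral_sub_mul_eq_MK
    (hK : Continuous fun p : unitInterval × unitInterval => K p.1 p.2)
    {f : unitInterval → ℝ} (hf : Continuous f) (x x' : unitInterval) (a b : ℝ) :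
    ∫ y, (a * K x' y - b * K x y) * f y = a * MK K f x' - b * MK K f x := by
  unfold MK
  rw [← integral_const_mul, ← integral_const_mul, ← integral_sub]
  · congr 1 with y
    ring
  · exact (integrable_of_continuous_unitInterval (continuous_kernel_mul hK hf x')).const_mul a
  · exact (integrable_of_continuous_unitInterval (continuous_kernel_mul hK hf x)).const_mul b

theorem continuous_kernel_sub
    (hK : Continuous fun p : unitInterval × unitInterval => K p.1 p.2)
    (x x' : unitInterval) (a b : ℝ) : Continuous fun y => a * K x' y - b * K x y :=
  (continuous_const.mul (hK.comp (Continuous.prodMk_right x'))).sub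
    (continuous_const.mul (hK.comp (Continuous.prodMk_right x)))

/-- The cross-ratio inequality for the kernel passes to the images of the cone. -/
theorem cross_le_MK (hK : Continuous fun p : unitInterval × unitInterval => K p.1 p.2)
    {β : ℝ} (h : ∀ x x' y y', β * (K x y * K x' y') ≤ K x' y * K x y')
    {f g : unitInterval → ℝ} (hf : InConeC f) (hg : InConeC g) (x x' : unitInterval) :
    β * (MK K f x * MK K g x') ≤ MK K f x' * MK K g x := by
  have h1 (y : unitInterval) : β * K x y * MK K g x' ≤ K x' y * MK K g x := by
    have := integral_sub_mul_eq_MK hK hg.1 x' x (K x' y) (β * K x y)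
    have h0 : 0 ≤ ∫ y', (K x' y * K x y' - β * K x y * K x' y') * g y' :=
      integral_nonneg fun y' => mul_nonneg (by linarith [h x x' y y']) (hg.2.2 y')
    linarith
  have := integral_sub_mul_eq_MK hK hf.1 x x' (MK K g x) (β * MK K g x')
  have h0 : 0 ≤ ∫ y, (MK K g x * K x' y - β * MK K g x' * K x y) * f y :=
    integral_nonneg fun y => mul_nonneg (by linarith [h1 y]) (hf.2.2 y)
  linarith

/-- A cross-ratio inequality on the images of the cone comes from one for the kernel. -/
theorem cross_le_kernel (hK : Continuous fun p : unitInterval × unitInterval => K p.1 p.2)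
    {β : ℝ} (h : ∀ f g, InConeC f → InConeC g → ∀ x x',
      β * (MK K f x * MK K g x') ≤ MK K f x' * MK K g x) (x x' y y' : unitInterval) :
    β * (K x y * K x' y') ≤ K x' y * K x y' := by
  have h1 (g : unitInterval → ℝ) (hg : InConeC g) :
      β * K x y * MK K g x' ≤ K x' y * MK K g x := by
    have := nonneg_of_integral_mul_nonneg
      (continuous_kernel_sub hK x x' (MK K g x) (β * MK K g x')) (fun f hf => by
        rw [integral_sub_mul_eq_MK hK hf.1]
        linarith [h f g hf hg x x']) y
    linarith
  have := nonneg_of_integral_mul_nonneg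
    (continuous_kernel_sub hK x' x (K x' y) (β * K x y)) (fun g hg => by
      rw [integral_sub_mul_eq_MK hK hg.1]
      linarith [h1 g hg]) y'
  linarith

theorem cK_lt_one_iff_cross
    (hK : Continuous fun p : unitInterval × unitInterval => K p.1 p.2)
    (hK0 : ∀ x y, 0 ≤ K x y) (hKpos : ∀ y, ∃ x, 0 < K x y) :
    cK K < 1 ↔ ∃ β : ℝ, 0 < β ∧ ∀ x x' y y', β * (K x y * K x' y') ≤ K x' y * K x y' := by
  constructor
  · intro hc
    have hle (f g) (hf : InConeC f) (hg : InConeC g) : dProj (MK K f) (MK K g) ≤ cK K :=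
      le_csSup ⟨1, by rintro _ ⟨f, g, -, -, rfl⟩; exact dProj_le_one⟩ ⟨f, g, hf, hg, rfl⟩
    have h1 : InConeC fun _ => (1 : ℝ) :=
      ⟨continuous_const, fun h => one_ne_zero (congrFun h 0), fun _ => zero_le_one⟩
    have hc0 : 0 ≤ cK K := by
      have hM := inConeC_MK hK hK0 hKpos h1
      exact (dProj_self_nonneg hM.2.2 hM.exists_pos).trans (hle _ _ h1 h1)
    refine ⟨(1 - cK K) / (1 + cK K), div_pos (by linarith) (by linarith),
      cross_le_kernel hK fun f g hf hg => cross_le_of_le_mRatio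
        (inConeC_MK hK hK0 hKpos hf).2.2 (inConeC_MK hK hK0 hKpos hg).2.2 ?_⟩
    have hm : 0 ≤ mRatio (MK K f) (MK K g) := mRatio_nonneg
    have h := hle f g hf hg
    unfold dProj at h
    rw [div_le_iff₀ (by linarith)] at h ⊢
    linarith
  · rintro ⟨β, hβ, h⟩
    have hlt : (1 - β ^ 2) / (1 + β ^ 2) < 1 := by
      rw [div_lt_one (by positivity)]
      linarith [pow_pos hβ 2]
    refine (Real.sSup_le ?_ (le_max_right _ 0)).trans_lt (max_lt hlt one_pos)
    rintro _ ⟨f, g, hf, hg, rfl⟩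
    refine le_max_of_le_left ?_
    have hF := inConeC_MK hK hK0 hKpos hf
    have hG := inConeC_MK hK hK0 hKpos hg
    have hm := le_mRatio_of_cross_le hF.2.2 hF.exists_pos hG.exists_pos hβ
      (cross_le_MK hK h hf hg)
    unfold dProj
    have hβ2 := pow_pos hβ 2
    rw [div_le_div_iff₀ (by linarith) (by linarith)]
    linarith

end Kernel

theorem cross_iff_exists_product_bounds {X Y : Type*} {K : X → Y → ℝ}
    (hK0 : ∀ x y, 0 ≤ K x y) (hKpos : ∃ x y, 0 < K x y) :
    (∃ β : ℝ, 0 < β ∧ ∀ x x' y y', β * (K x y * K x' y') ≤ K x' y * K x y') ↔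
      ∃ (g₁ : X → ℝ) (g₂ : Y → ℝ), (∀ x, 0 ≤ g₁ x) ∧ (∀ y, 0 ≤ g₂ y) ∧
        ∃ A : ℝ, 0 < A ∧ ∀ x y,
          A⁻¹ * g₁ x * g₂ y ≤ K x y ∧ K x y ≤ A * g₁ x * g₂ y := by
  constructor
  · rintro ⟨β, hβ, h⟩
    obtain ⟨x₀, y₀, hk⟩ := hKpos
    set k := K x₀ y₀
    refine ⟨fun x => K x y₀, fun y => K x₀ y, fun x => hK0 x y₀, fun y => hK0 x₀ y,
      max (k / β) (1 / (β * k)), lt_max_of_lt_left (div_pos hk hβ), fun x y => ⟨?_, ?_⟩⟩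
    · have h1 : β * (K x y₀ * K x₀ y) ≤ k * K x y := h x x₀ y₀ y
      have h2 : (max (k / β) (1 / (β * k)))⁻¹ ≤ (k / β)⁻¹ :=
        inv_anti₀ (div_pos hk hβ) (le_max_left _ _)
      calc _ ≤ (k / β)⁻¹ * (K x y₀ * K x₀ y) := by
            rw [mul_assoc]
            exact mul_le_mul_of_nonneg_right h2 (mul_nonneg (hK0 _ _) (hK0 _ _))
        _ = β * (K x y₀ * K x₀ y) / k := by field_simp
        _ ≤ K x y := by rw [div_le_iff₀ hk]; linarith
    · have h1 : β * (K x y * k) ≤ K x₀ y * K x y₀ := h x x₀ y y₀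
      calc K x y ≤ 1 / (β * k) * (K x y₀ * K x₀ y) := by
            rw [div_mul_eq_mul_div, le_div_iff₀ (by positivity)]
            linarith
        _ ≤ _ := by
            rw [mul_assoc (max _ _)]
            exact mul_le_mul_of_nonneg_right (le_max_right _ _)
              (mul_nonneg (hK0 _ _) (hK0 _ _))
  · rintro ⟨g₁, g₂, h₁, h₂, A, hA, h⟩
    refine ⟨(A ^ 4)⁻¹, by positivity, fun x x' y y' => ?_⟩
    have hnn (x : X) (y : Y) : 0 ≤ A * g₁ x * g₂ y :=
      mul_nonneg (mul_nonneg hA.le (h₁ x)) (h₂ y)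
    have hnn' (x : X) (y : Y) : 0 ≤ A⁻¹ * g₁ x * g₂ y :=
      mul_nonneg (mul_nonneg (inv_pos.2 hA).le (h₁ x)) (h₂ y)
    calc (A ^ 4)⁻¹ * (K x y * K x' y')
        ≤ (A ^ 4)⁻¹ * ((A * g₁ x * g₂ y) * (A * g₁ x' * g₂ y')) :=
          mul_le_mul_of_nonneg_left
            (mul_le_mul (h x y).2 (h x' y').2 (hK0 _ _) (hnn x y)) (by positivity)
      _ = (A⁻¹ * g₁ x' * g₂ y) * (A⁻¹ * g₁ x * g₂ y') := by field_simp
      _ ≤ K x' y * K x y' := mul_le_mul (h x' y).1 (h x y').1 (hnn' x y') (hK0 _ _)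

theorem stmt_19 (K : unitInterval → unitInterval → ℝ)
    (hKcont : Continuous fun p : unitInterval × unitInterval => K p.1 p.2)
    (hKnonneg : ∀ x y, 0 ≤ K x y)
    (hKpos : ∀ y, ∃ x, 0 < K x y) :
    (∀ f, InConeC f → InConeC (MK K f)) ∧
    (cK K < 1 ↔ ∃ g₁ g₂ : unitInterval → ℝ,
      (∀ x, 0 ≤ g₁ x) ∧ (∀ y, 0 ≤ g₂ y) ∧
      ∃ A : ℝ, 0 < A ∧ ∀ x y,
        A⁻¹ * g₁ x * g₂ y ≤ K x y ∧ K x y ≤ A * g₁ x * g₂ y) := by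
  obtain ⟨x, hx⟩ := hKpos 0
  exact ⟨fun f hf => inConeC_MK hKcont hKnonneg hKpos hf,
    (cK_lt_one_iff_cross hKcont hKnonneg hKpos).trans
      (cross_iff_exists_product_bounds hKnonneg ⟨x, 0, hx⟩)⟩
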